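/- (Normal base change.) Let R → S be a homomorphism of Noetherian rings that is flat with geometrically normal fibers, and let L ⊆ M be R-modules. Then the image of lic(L,M) ⊗_R S → M ⊗_R S equals the liftable integral closure, as S-modules, of the image of L ⊗_R S → M ⊗_R S inside M ⊗_R S. -/

import Mathlib

/- # Liftable integral closure: core definitions

Free $R$-modules are modeled as `ι →₀ R`, and the symmetric algebra of `ι →₀ R`
is modeled as `MvPolynomial ι R`, with the canonical degree-one embedding sending
the basis vector at `i` to the variable `X i`. -/

noncomputable section

open scoped TensorProduct

namespace LIC

variable (R : Type*) [CommRing R]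

/-- The canonical embedding of the free module `ι →₀ R` onto the degree-one part of its
symmetric algebra `MvPolynomial ι R`. -/
def symEmb (ι : Type*) : (ι →₀ R) →ₗ[R] MvPolynomial ι R :=
  Finsupp.linearCombination R MvPolynomial.X

variable {R}

/-- The integral closure `U⁻_F` of a submodule `U` of the free module `F = ι →₀ R`:
the degree-one part of the integral closure, inside the symmetric algebra of `F`,
of the subalgebra generated by `U`. -/
def freeIC {ι : Type*} (U : Submodule R (ι →₀ R)) : Submodule R (ι →₀ R) where
  carrier := {x | IsIntegral (Algebra.adjoin R (symEmb R ι '' U)) (symEmb R ι x)}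
  zero_mem' := by simpa using isIntegral_zero
  add_mem' := by
    intro a b ha hb
    simpa [map_add] using ha.add hb
  smul_mem' := by
    intro c x hx
    have hc : IsIntegral (Algebra.adjoin R (symEmb R ι '' ↑U))
        ((algebraMap R (MvPolynomial ι R)) c) := by
      have : (algebraMap R (MvPolynomial ι R)) c
          = algebraMap (Algebra.adjoin R (symEmb R ι '' ↑U)) (MvPolynomial ι R)
            ⟨(algebraMap R (MvPolynomial ι R)) c,
              Subalgebra.algebraMap_mem _ c⟩ := rfl
      rw [this]
      exact isIntegral_algebraMap
    have : symEmb R ι (c • x) = (algebraMap R (MvPolynomial ι R)) c * symEmb R ι x := by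
      rw [map_smul, Algebra.smul_def]
    simpa [Set.mem_setOf_eq, this] using hc.mul hx
  
/-- The liftable integral closure `lic(L, M)` of a submodule `L ⊆ M`, computed via the
canonical free presentation `M →₀ R ↠ M`.  (By `LIC.lic_indep` this agrees with the
closure computed from any surjection of a free module onto `M`.) -/
def lic {M : Type*} [AddCommGroup M] [Module R M] (L : Submodule R M) : Submodule R M :=
  Submodule.map (Finsupp.linearCombination R (id : M → M))
    (freeIC (Submodule.comap (Finsupp.linearCombination R (id : M → M)) L))

end LIC

end

namespace LIC

open scoped TensorProduct

/-- A commutative ring is normal if its localization at every prime ideal is an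
integrally closed domain. -/
def IsNormalRing (A : Type*) [CommRing A] : Prop :=
  ∀ (q : Ideal A) (_ : q.IsPrime),
    IsDomain (Localization.AtPrime q) ∧ IsIntegrallyClosed (Localization.AtPrime q)

universe v

/-- An `R`-algebra `S` has geometrically normal fibers if for every prime `p ⊆ R` and
every finite field extension `K` of the residue field `κ(p) = Frac(R/p)`, the
base-changed fiber `K ⊗_R S` is a normal ring. -/
def HasGeometricallyNormalFibers (R : Type*) (S : Type*) [CommRing R] [CommRing S]
    [Algebra R S] : Prop :=
  ∀ (p : Ideal R) (_ : p.IsPrime)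
    (K : Type v) (_ : Field K) (_ : Algebra (R ⧸ p) K) (_ : NoZeroSMulDivisors (R ⧸ p) K)
    (_ : Algebra R K) (_ : IsScalarTower R (R ⧸ p) K),
    (letI := FractionRing.liftAlgebra (R ⧸ p) K
     FiniteDimensional (FractionRing (R ⧸ p)) K) →
    IsNormalRing (K ⊗[R] S)

end LIC

namespace LIC
open scoped TensorProduct

theorem isReduced_tensor_of_ft {k A B : Type*} [Field k] [IsAlgClosed k] [CommRing A] [CommRing B]
    [Algebra k A] [Algebra k B] [IsReduced A] [IsReduced B] [Algebra.FiniteType k B] :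
    IsReduced (A ⊗[k] B) := by
  classical
  refine ⟨fun x hx => ?_⟩
  let b := Module.Free.chooseBasis k A
  apply (TensorProduct.equivFinsuppOfBasisLeft (N := B) b).injective
  rw [map_zero]
  ext i
  rw [TensorProduct.equivFinsuppOfBasisLeft_apply, Finsupp.zero_apply]
  set y := TensorProduct.lid k B ((b.coord i).rTensor _ x) with hy
  have : IsJacobsonRing B := isJacobsonRing_of_finiteType (A := k)
  have h0 : y ∈ (⊥ : Ideal B).jacobson := by
    rw [Ideal.jacobson, Submodule.mem_sInf]
    rintro m ⟨-, hm⟩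
    letI : Field (B ⧸ m) := Ideal.Quotient.field m
    have hfin : Module.Finite k (B ⧸ m) := finite_of_finite_type_of_isJacobsonRing k (B ⧸ m)
    have hbij : Function.Bijective (algebraMap k (B ⧸ m)) :=
      IsAlgClosed.algebraMap_bijective_of_isIntegral
    let e : k ≃ₐ[k] (B ⧸ m) := AlgEquiv.ofBijective (Algebra.ofId k _) hbij
    let g : B →ₐ[k] k := e.symm.toAlgHom.comp (Ideal.Quotient.mkₐ k m)
    let G : A ⊗[k] B →ₐ[k] A :=
      (Algebra.TensorProduct.rid k k A).toAlgHom.comp (Algebra.TensorProduct.map (AlgHom.id k A) g)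
    have hG : G x = 0 := (hx.map G).eq_zero
    have hgy : g y = b.coord i (G x) := by
      rw [hy]
      clear_value b
      clear hx hG hy y
      induction x with
      | zero => simp
      | add x y hx hy => simp only [map_add, hx, hy]
      | tmul a c => simp [G, mul_comm]
    rw [hG, map_zero] at hgy
    have : Ideal.Quotient.mk m y = 0 := by
      apply e.symm.injective
      rw [map_zero]; exact hgy
    exact Ideal.Quotient.eq_zero_iff_mem.mp this
  rw [IsJacobsonRing.out this (by intro z hz; exact (mem_nilradical.mp hz).eq_zero)] at h0
  exact h0

theorem isReduced_tensor {k A B : Type*} [Field k] [IsAlgClosed k] [CommRing A] [CommRing B]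
    [Algebra k A] [Algebra k B] [IsReduced A] [IsReduced B] :
    IsReduced (A ⊗[k] B) := by
  apply IsReduced.tensorProduct_of_flat_of_forall_fg
  intro C hC
  have : Algebra.FiniteType k C := C.fg_iff_finiteType.mp hC
  have : IsReduced C := isReduced_of_injective C.val Subtype.val_injective
  exact isReduced_tensor_of_ft

theorem isReduced_tensor_tensor {R T k : Type*} [CommRing R] [CommRing T] [Field k] [IsAlgClosed k]
    [Algebra R T] [Algebra R k] (h : IsReduced (k ⊗[R] T)) : IsReduced (k ⊗[R] (T ⊗[R] T)) := by
  have h2 : IsReduced ((k ⊗[R] T) ⊗[k] (k ⊗[R] T)) := isReduced_tensor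
  let e1 := Algebra.TensorProduct.cancelBaseChange R k k (k ⊗[R] T) T
  let e2 := Algebra.TensorProduct.assoc R R k k T T
  exact isReduced_of_injective (e1.symm.toRingEquiv.toRingHom.comp e2.symm.toRingEquiv.toRingHom)
    (e1.symm.injective.comp e2.symm.injective)
end LIC

namespace LIC
open scoped TensorProduct
universe u
section core
variable {R B Q F : Type u} [CommRing R] [CommRing B] [CommRing Q] [Algebra R B] [Algebra R Q]
  [AddCommGroup F] [Module R F] (ψ : B →ₐ[R] Q) (φ : F →ₗ[R] Q)

/-- elements of `F` whose image in `Q` is integral over `B`. -/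
def icl : Submodule R F where
  carrier := {x | (ψ : B →+* Q).IsIntegralElem (φ x)}
  zero_mem' := by
    simpa using RingHom.isIntegralElem_zero (ψ : B →+* Q)
  add_mem' := by
    intro a b ha hb
    simpa using ha.add _ hb
  smul_mem' := by
    intro c x hx
    have hc : (ψ : B →+* Q).IsIntegralElem (algebraMap R Q c) := by
      rw [← ψ.commutes]; exact RingHom.isIntegralElem_map (ψ : B →+* Q)
    simpa [Algebra.smul_def] using hc.mul _ hx

variable (T : Type u) [CommRing T] [Algebra R T]

/-- base change of the structure map. -/
abbrev psiT : T ⊗[R] B →+* T ⊗[R] Q :=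
  (Algebra.TensorProduct.map (AlgHom.id R T) ψ : T ⊗[R] B →ₐ[R] T ⊗[R] Q)

/-- base changed integral closure. -/
def iclT : Submodule T (T ⊗[R] F) where
  carrier := {x | (psiT ψ T).IsIntegralElem (φ.baseChange T x)}
  zero_mem' := by
    simpa using RingHom.isIntegralElem_zero (psiT ψ T)
  add_mem' := by
    intro a b ha hb
    simpa using ha.add _ hb
  smul_mem' := by
    intro c x hx
    have hc : (psiT ψ T).IsIntegralElem (algebraMap T (T ⊗[R] Q) c) := by
      have : algebraMap T (T ⊗[R] Q) c = psiT ψ T (c ⊗ₜ 1) := by simp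
      rw [this]; exact RingHom.isIntegralElem_map (psiT ψ T)
    simpa [Algebra.smul_def] using hc.mul _ hx

/-- the quotient module -/
abbrev EE := F ⧸ icl ψ φ

/-- The image of the base changed integral closure in the quotient. -/
def HH : Submodule T (T ⊗[R] EE ψ φ) :=
  (iclT ψ φ T).map ((icl ψ φ).mkQ.baseChange T)

theorem mem_iclT_of_base {x : F} (hx : x ∈ icl ψ φ) (t : T) : t ⊗ₜ x ∈ iclT ψ φ T := by
  have : t ⊗ₜ[R] x = t • ((1 : T) ⊗ₜ[R] x) := by simp [TensorProduct.smul_tmul']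
  rw [this]
  apply Submodule.smul_mem
  obtain ⟨p, hp, hpx⟩ := hx
  refine ⟨p.map (Algebra.TensorProduct.includeRight : B →ₐ[R] T ⊗[R] B).toRingHom, hp.map _, ?_⟩
  have h2 : (psiT ψ T).comp (Algebra.TensorProduct.includeRight : B →ₐ[R] T ⊗[R] B).toRingHom =
    (Algebra.TensorProduct.includeRight : Q →ₐ[R] T ⊗[R] Q).toRingHom.comp (ψ : B →+* Q) := by
    ext; simp
  rw [Polynomial.eval₂_map, h2]
  have := congr((Algebra.TensorProduct.includeRight : Q →ₐ[R] T ⊗[R] Q).toRingHom $hpx)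
  rw [Polynomial.hom_eval₂] at this
  simpa using this

theorem range_le_iclT (z : T ⊗[R] icl ψ φ) :
    (icl ψ φ).subtype.baseChange T z ∈ iclT ψ φ T := by
  induction z with
  | zero => simp
  | add x y hx hy => rw [map_add]; exact add_mem hx hy
  | tmul t x => simpa using mem_iclT_of_base ψ φ T x.2 t

/-- any lift of an element of `HH` is integral. -/
theorem mem_iclT_of_mk {z : T ⊗[R] F} (hz : (icl ψ φ).mkQ.baseChange T z ∈ HH ψ φ T) :
    z ∈ iclT ψ φ T := by
  obtain ⟨y, hy, hyz⟩ := hz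
  have hex : Function.Exact ((icl ψ φ).subtype.lTensor T) ((icl ψ φ).mkQ.lTensor T) :=
    lTensor_exact T (LinearMap.exact_subtype_mkQ _) (Submodule.mkQ_surjective _)
  have h0 : (icl ψ φ).mkQ.lTensor T (z - y) = 0 := by
    have : (icl ψ φ).mkQ.baseChange T (z - y) = 0 := by rw [map_sub, hyz, sub_self]
    exact this
  obtain ⟨w, hw⟩ := (hex _).mp h0
  have := range_le_iclT ψ φ T w
  have h3 : (icl ψ φ).subtype.baseChange T w = z - y := hw
  rw [h3] at this
  simpa using add_mem this hy

variable {T}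
/-- functoriality -/
theorem HH_map {T' : Type u} [CommRing T'] [Algebra R T'] (g : T →ₐ[R] T')
    {y : T ⊗[R] EE ψ φ} (hy : y ∈ HH ψ φ T) :
    g.toLinearMap.rTensor _ y ∈ HH ψ φ T' := by
  obtain ⟨z, hz, rfl⟩ := hy
  refine ⟨g.toLinearMap.rTensor _ z, ?_, ?_⟩
  · obtain ⟨p, hp, hpx⟩ := hz
    refine ⟨p.map (Algebra.TensorProduct.map g (AlgHom.id R B)).toRingHom, hp.map _, ?_⟩
    have h2 : (psiT ψ T').comp (Algebra.TensorProduct.map g (AlgHom.id R B)).toRingHom =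
        (Algebra.TensorProduct.map g (AlgHom.id R Q)).toRingHom.comp (psiT ψ T) := by
      apply RingHom.ext
      intro x
      induction x with
      | zero => simp
      | add x y hx hy => rw [map_add, map_add, hx, hy]
      | tmul a b => simp
    rw [Polynomial.eval₂_map, h2]
    have := congr((Algebra.TensorProduct.map g (AlgHom.id R Q)).toRingHom $hpx)
    rw [Polynomial.hom_eval₂, map_zero] at this
    rw [← this]
    congr 1
    clear hpx this
    induction z with
    | zero => simp
    | add x y hx hy => simp only [map_add, hx, hy]
    | tmul a b => simp
  · clear hz
    induction z with
    | zero => simp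
    | add x y hx hy => simp only [map_add, hx, hy]
    | tmul a b => simp

theorem key_nilp [Module.Flat R T] (p : Ideal R) {K : Type*} [CommRing K] [Algebra R K]
    (hK : ∀ r ∈ p, algebraMap R K r = 0) (w : EE ψ φ) (hw : ∀ r : R, r • w = 0 → r ∈ p)
    (c : T) (h : c ⊗ₜ w ∈ HH ψ φ T) : IsNilpotent ((1 : K) ⊗ₜ[R] c) := by
  obtain ⟨w, rfl⟩ := (icl ψ φ).mkQ_surjective w
  have h1 : c ⊗ₜ w ∈ iclT ψ φ T := mem_iclT_of_mk ψ φ T (by simpa using h)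
  obtain ⟨P, hP, hPc⟩ := h1
  set m := P.natDegree with hm
  let N : Submodule R Q := Submodule.span R {y | ∃ b : B, ∃ i < m, y = ψ b * φ w ^ i}
  -- the `m`-th power lies in the base change of `N`
  have hmem : ∀ (x : T ⊗[R] B) (i : ℕ), i < m →
      N.mkQ.lTensor T (psiT ψ T x * (c ⊗ₜ[R] φ w) ^ i) = 0 := by
    intro x i hi
    induction x with
    | zero => simp
    | add x y hx hy => rw [map_add, add_mul, map_add, hx, hy, add_zero]
    | tmul t b =>
      have hb : ψ b * φ w ^ i ∈ N := Submodule.subset_span ⟨b, i, hi, rfl⟩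
      have : N.mkQ (ψ b * φ w ^ i) = 0 := (Submodule.Quotient.mk_eq_zero _).mpr hb
      simp only [Algebra.TensorProduct.tmul_pow,
        Algebra.TensorProduct.map_tmul, Algebra.TensorProduct.tmul_mul_tmul,
        LinearMap.lTensor_tmul, RingHom.coe_coe, this, TensorProduct.tmul_zero]
  have htop : N.mkQ.lTensor T ((c ⊗ₜ[R] φ w) ^ m) = 0 := by
    have h3 := hPc
    rw [Polynomial.eval₂_eq_sum_range, Finset.sum_range_succ, ← hm] at h3
    have h4 : P.coeff m = 1 := hP.coeff_natDegree
    rw [h4, map_one, one_mul] at h3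
    have h5 := congr(N.mkQ.lTensor T $h3)
    rw [map_add, map_sum, map_zero, Finset.sum_eq_zero, zero_add] at h5
    · simpa using h5
    · intro i hi
      simpa using hmem (P.coeff i) i (Finset.mem_range.mp hi)
  let f : R →ₗ[R] Q ⧸ N := LinearMap.toSpanSingleton R _ (N.mkQ (φ w ^ m))
  have hf : f.lTensor T ((c ^ m) ⊗ₜ[R] (1 : R)) = 0 := by
    simpa [f, Algebra.TensorProduct.tmul_pow] using htop
  have hker : ∀ r ∈ LinearMap.ker f, r ∈ p := by
    intro r hr
    apply hw
    have hr' : r • φ w ^ m ∈ N := by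
      have : N.mkQ (r • φ w ^ m) = 0 := by simpa [f] using hr
      exact (Submodule.Quotient.mk_eq_zero _).mp this
    rw [← map_smul]
    apply (Submodule.Quotient.mk_eq_zero _).mpr
    -- `r • w` is integral
    have hN : ∀ y ∈ N, ∃ q : Polynomial B, q.degree < m ∧ q.eval₂ (ψ : B →+* Q) (φ w) = y := by
      intro y hy
      induction hy using Submodule.span_induction with
      | mem x h =>
        obtain ⟨b, i, hi, rfl⟩ := h
        refine ⟨Polynomial.C b * Polynomial.X ^ i, ?_, by simp⟩
        exact (Polynomial.degree_C_mul_X_pow_le _ _).trans_lt (by exact_mod_cast hi)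
      | zero => exact ⟨0, by simp, by simp⟩
      | add x y _ _ hx hy =>
        obtain ⟨q, hq, rfl⟩ := hx
        obtain ⟨q', hq', rfl⟩ := hy
        exact ⟨q + q', (Polynomial.degree_add_le _ _).trans_lt (max_lt hq hq'), by simp⟩
      | smul a x _ hx =>
        obtain ⟨q, hq, rfl⟩ := hx
        refine ⟨Polynomial.C (algebraMap R B a) * q, ?_, ?_⟩
        · refine lt_of_le_of_lt ?_ hq
          exact (Polynomial.degree_mul_le _ _).trans
            ((add_le_add_left Polynomial.degree_C_le _).trans (by simp))
        · simp [Polynomial.eval₂_mul, Algebra.smul_def]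
    obtain ⟨q, hq, hqy⟩ := hN _ hr'
    let a : B := algebraMap R B r
    have ha : ψ a = algebraMap R Q r := by simp [a]
    show (ψ : B →+* Q).IsIntegralElem (φ (r • w))
    rw [map_smul, Algebra.smul_def, ← ha]
    rw [Algebra.smul_def, ← ha] at hqy
    by_cases hm0 : m = 0
    · -- then the polynomial is zero
      rw [hm0] at hq
      have hq0 : q = 0 := by
        rw [← Polynomial.degree_eq_bot]
        exact Nat.WithBot.lt_zero_iff.mp hq
      rw [hq0, hm0] at hqy
      have : ψ a = 0 := by simpa using hqy.symm
      rw [this, zero_mul]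
      exact RingHom.isIntegralElem_zero (ψ : B →+* Q)
    · obtain ⟨k, hk⟩ : ∃ k, m = k + 1 := Nat.exists_eq_succ_of_ne_zero hm0
      refine ⟨Polynomial.X ^ m - ∑ i ∈ Finset.range m,
        Polynomial.C (q.coeff i * a ^ (k - i)) * Polynomial.X ^ i, ?_, ?_⟩
      · apply Polynomial.monic_X_pow_sub
        refine (Polynomial.degree_sum_le _ _).trans_lt ?_
        refine (Finset.sup_lt_iff (WithBot.bot_lt_coe m)).2 fun i hi => ?_
        exact (Polynomial.degree_C_mul_X_pow_le _ _).trans_lt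
          (WithBot.coe_lt_coe.2 (Finset.mem_range.mp hi))
      · rw [Polynomial.eval₂_sub, Polynomial.eval₂_finsetSum, sub_eq_zero]
        rw [Polynomial.eval₂_eq_sum_range' (ψ : B →+* Q)
          (show q.natDegree < m by
            by_cases hq0 : q = 0
            · rw [hq0]; simpa using Nat.pos_of_ne_zero hm0
            · exact (Polynomial.natDegree_lt_iff_degree_lt hq0).mpr hq)] at hqy
        have h7 : (ψ a * φ w) ^ m = ψ a ^ k * (ψ a * φ w ^ m) := by rw [hk]; ring
        simp only [Polynomial.eval₂_X_pow]
        rw [h7, ← hqy, Finset.mul_sum]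
        refine Finset.sum_congr rfl fun i hi => ?_
        have hi' : i ≤ k := by have := Finset.mem_range.mp hi; omega
        obtain ⟨l, rfl⟩ := Nat.exists_eq_add_of_le hi'
        rw [Polynomial.eval₂_mul, Polynomial.eval₂_C, Polynomial.eval₂_X_pow]
        simp only [RingHom.coe_coe, map_mul, map_pow, Nat.add_sub_cancel_left]
        ring
  have hex : Function.Exact ((LinearMap.ker f).subtype.lTensor T) (f.lTensor T) :=
    Module.Flat.lTensor_exact T (LinearMap.exact_subtype_ker_map f)
  obtain ⟨z, hz⟩ := (hex _).mp hf
  refine ⟨m, ?_⟩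
  rw [Algebra.TensorProduct.tmul_pow, one_pow]
  have hz2 : c ^ m = TensorProduct.rid R T ((LinearMap.ker f).subtype.lTensor T z) := by
    rw [hz]; simp
  rw [hz2]
  clear hz hz2
  induction z with
  | zero => simp
  | add x y hx hy => simp only [map_add, TensorProduct.tmul_add, hx, hy, add_zero]
  | tmul t r =>
    simp only [LinearMap.lTensor_tmul, Submodule.subtype_apply, TensorProduct.rid_tmul]
    rw [TensorProduct.tmul_smul, TensorProduct.smul_tmul', Algebra.smul_def,
      hK _ (hker _ r.2), zero_mul, TensorProduct.zero_tmul]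
end core
end LIC

namespace LIC
open scoped TensorProduct
universe u
section loc
variable {R : Type*} [CommRing R] (p : Ideal R) [p.IsPrime] (K : Type*) [Field K]
  [Algebra R K] [Algebra (R ⧸ p) K] [IsScalarTower R (R ⧸ p) K] [IsFractionRing (R ⧸ p) K]

theorem algebraMap_K_eq_zero {r : R} : algebraMap R K r = 0 ↔ r ∈ p := by
  rw [IsScalarTower.algebraMap_apply R (R ⧸ p) K]
  rw [map_eq_zero_iff _ (IsFractionRing.injective (R ⧸ p) K)]
  exact Ideal.Quotient.eq_zero_iff_mem

theorem isLocMod : IsLocalizedModule p.primeCompl (IsScalarTower.toAlgHom R (R ⧸ p) K).toLinearMap := by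
  rw [isLocalizedModule_iff_isLocalization]
  have : Algebra.algebraMapSubmonoid (R ⧸ p) p.primeCompl = nonZeroDivisors (R ⧸ p) := by
    ext x
    rw [mem_nonZeroDivisors_iff_ne_zero]
    constructor
    · rintro ⟨r, hr, rfl⟩ h
      exact hr (Ideal.Quotient.eq_zero_iff_mem.mp h)
    · intro hx
      obtain ⟨r, rfl⟩ := Ideal.Quotient.mk_surjective x
      exact ⟨r, fun h => hx (Ideal.Quotient.eq_zero_iff_mem.mpr h), rfl⟩
  rw [this]
  infer_instance

variable {E P : Type*} [AddCommGroup E] [Module R E] [AddCommGroup P] [Module R P]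

/-- The map `R ⧸ p → E` attached to an element killed by `p`. -/
noncomputable def toE (e : E) (he : ∀ r ∈ p, r • e = 0) : (R ⧸ p) →ₗ[R] E :=
  Submodule.liftQ p (LinearMap.toSpanSingleton R E e) (by
    intro r hr; simpa using he r hr)

theorem toE_mk (e : E) (he : ∀ r ∈ p, r • e = 0) (r : R) :
    toE p e he (Ideal.Quotient.mk p r) = r • e := by
  exact Submodule.liftQ_apply p (LinearMap.toSpanSingleton R E e) r

theorem loc0 {x : P} (hx : (1 : K) ⊗ₜ[R] x = 0) (e : E) (he : ∀ r ∈ p, r • e = 0) :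
    ∃ s, s ∉ p ∧ s • (x ⊗ₜ[R] e) = 0 := by
  have h1 := isLocMod p K
  have h2 : IsLocalizedModule p.primeCompl (TensorProduct.AlgebraTensorModule.rTensor R P
    (IsScalarTower.toAlgHom R (R ⧸ p) K).toLinearMap) := inferInstance
  have h3 : TensorProduct.AlgebraTensorModule.rTensor R P
    (IsScalarTower.toAlgHom R (R ⧸ p) K).toLinearMap ((1 : R ⧸ p) ⊗ₜ[R] x) = 0 := by
    simpa using hx
  rw [IsLocalizedModule.eq_zero_iff p.primeCompl] at h3
  obtain ⟨s, hs⟩ := h3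
  refine ⟨s, s.2, ?_⟩
  have h4 := congr(TensorProduct.comm R E P ((toE p e he).rTensor P $hs))
  have h5 : toE p e he 1 = e := by
    have := toE_mk p e he 1
    simpa using this
  have h6 : s • ((1 : R ⧸ p) ⊗ₜ[R] x) = (s : R) • ((1 : R ⧸ p) ⊗ₜ[R] x) := rfl
  rw [h6, map_smul, map_smul] at h4
  simpa [h5] using h4

theorem indep0 [Module.Flat R P] {n : ℕ} (e : Fin n → E) (he : ∀ i, ∀ r ∈ p, r • e i = 0)
    (hind : ∀ r : Fin n → R, ∑ i, r i • e i = 0 → ∀ i, r i ∈ p) (x : Fin n → P)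
    (hx : ∑ i, x i ⊗ₜ[R] e i = 0) (i : Fin n) : (1 : K) ⊗ₜ[R] x i = 0 := by
  classical
  let j : (Fin n → R ⧸ p) →ₗ[R] E := ∑ i, (toE p (e i) (he i)).comp (LinearMap.proj i)
  have hj : Function.Injective j := by
    rw [← LinearMap.ker_eq_bot, LinearMap.ker_eq_bot']
    intro d hd
    choose r hr using fun i => Ideal.Quotient.mk_surjective (d i)
    have : ∑ i, r i • e i = 0 := by
      rw [← hd]
      simp only [j, LinearMap.sum_apply, LinearMap.comp_apply, LinearMap.proj_apply]
      exact Finset.sum_congr rfl fun i _ => by rw [← hr, toE_mk]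
    ext i
    rw [← hr]
    exact Ideal.Quotient.eq_zero_iff_mem.mpr (hind r this i)
  have hj2 : Function.Injective (j.lTensor P) := Module.Flat.lTensor_preserves_injective_linearMap j hj
  have h0 : ∑ i, x i ⊗ₜ[R] (Pi.single i 1 : Fin n → R ⧸ p) = 0 := by
    apply hj2
    rw [map_zero, map_sum, ← hx]
    refine Finset.sum_congr rfl fun i _ => ?_
    rw [LinearMap.lTensor_tmul]
    congr 1
    simp only [j, LinearMap.sum_apply, LinearMap.comp_apply, LinearMap.proj_apply]
    rw [Finset.sum_eq_single i]
    · have := toE_mk p (e i) (he i) 1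
      simpa using this
    · intro k _ hk
      rw [Pi.single_eq_of_ne hk, map_zero]
    · simp
  have h1 := congr(((IsScalarTower.toAlgHom R (R ⧸ p) K).toLinearMap.comp
    (LinearMap.proj i : (Fin n → R ⧸ p) →ₗ[R] R ⧸ p)).lTensor P $h0)
  rw [map_sum, map_zero, Finset.sum_eq_single i] at h1
  · have h2 := congr(TensorProduct.comm R P K $h1)
    simpa using h2
  · intro k _ hk
    simp [Pi.single_eq_of_ne hk.symm]
  · simp
end loc
end LIC

namespace LIC
open scoped TensorProduct
universe u
section ind
variable {R B Q F : Type u} [CommRing R] [CommRing B] [CommRing Q] [Algebra R B] [Algebra R Q]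
  [AddCommGroup F] [Module R F] (ψ : B →ₐ[R] Q) (φ : F →ₗ[R] Q)

theorem isReduced_K (K Ω : Type*) [Field K] [Field Ω] [Algebra R K] [Algebra R Ω] [Algebra K Ω]
    [IsScalarTower R K Ω] {T : Type u} [CommRing T] [Algebra R T] [Module.Flat R T]
    [IsReduced (Ω ⊗[R] T)] : IsReduced (K ⊗[R] T) :=
  isReduced_of_injective
    (Algebra.TensorProduct.map (IsScalarTower.toAlgHom R K Ω) (AlgHom.id R T))
    (Module.Flat.rTensor_preserves_injective_linearMap (M := T)
      (IsScalarTower.toAlgHom R K Ω).toLinearMap (algebraMap K Ω).injective)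

/-- symmetric tensors are proportional. -/
theorem prop_of_symm (K : Type*) [Field K] [Algebra R K] {T : Type u} [CommRing T] [Algebra R T] (f : K ⊗[R] T →ₗ[K] K) (a b : T)
    (h : (1 : K) ⊗ₜ[R] (a ⊗ₜ[R] b - b ⊗ₜ[R] a) = 0) :
    f (1 ⊗ₜ a) • ((1 : K) ⊗ₜ[R] b) = f (1 ⊗ₜ b) • ((1 : K) ⊗ₜ[R] a) := by
  let g : T ⊗[R] T →ₗ[R] K ⊗[R] T := TensorProduct.lift
    (LinearMap.mk₂ R (fun x y => f (1 ⊗ₜ x) • ((1 : K) ⊗ₜ[R] y))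
      (by intro x y z; simp [TensorProduct.tmul_add, add_smul])
      (by intro c x y
          rw [TensorProduct.tmul_smul, LinearMap.map_smul_of_tower, smul_assoc])
      (by intro x y z; simp [TensorProduct.tmul_add])
      (by intro c x y
          rw [TensorProduct.tmul_smul, smul_comm]))
  have h1 := congr(g.liftBaseChange K $h)
  simpa [g, sub_eq_zero] using h1

theorem core_ind
    (p : Ideal R) [p.IsPrime] (K : Type*) [Field K]
    [Algebra R K] [Algebra (R ⧸ p) K] [IsScalarTower R (R ⧸ p) K] [IsFractionRing (R ⧸ p) K]
    (Ω : Type*) [Field Ω] [IsAlgClosed Ω] [Algebra R Ω] [Algebra K Ω] [IsScalarTower R K Ω] (n : ℕ) : ∀ (T : Type u) [CommRing T] [Algebra R T] [Module.Flat R T]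
    [IsReduced (Ω ⊗[R] T)] (e : Fin n → EE ψ φ) (_ : ∀ i, ∀ r ∈ p, r • e i = 0) (a : Fin n → T),
    ∑ i, a i ⊗ₜ[R] e i ∈ HH ψ φ T → ∃ s, s ∉ p ∧ s • ∑ i, a i ⊗ₜ[R] e i = 0 := by
  have hmul : ∀ {s t : R}, s ∉ p → t ∉ p → s * t ∉ p := fun hs ht h =>
    (Ideal.IsPrime.mem_or_mem ‹_› h).elim hs ht
  induction n with
  | zero =>
    intro T _ _ _ _ e he a _
    exact ⟨1, (Ideal.ne_top_iff_one p).mp (Ideal.IsPrime.ne_top ‹_›), by simp⟩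
  | succ n ih =>
    intro T _ _ _ _ e he a hv
    set v := ∑ i, a i ⊗ₜ[R] e i with hvdef
    have hHs : ∀ r : R, r • v ∈ HH ψ φ T := fun r => by
      rw [← algebraMap_smul T r v]; exact Submodule.smul_mem _ _ hv
    by_cases hind : ∀ r : Fin (n + 1) → R, ∑ i, r i • e i = 0 → ∀ i, r i ∈ p
    swap
    · push Not at hind
      obtain ⟨r, hr, j, hj⟩ := hind
      have h1 : r j • v = ∑ i : Fin n, (r j • a (j.succAbove i) - r (j.succAbove i) • a j)
          ⊗ₜ[R] e (j.succAbove i) := by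
        have h2 : r j • v = ∑ i, (r j • a i - r i • a j) ⊗ₜ[R] e i := by
          have h3 : ∑ i, (r i • a j) ⊗ₜ[R] e i = 0 := by
            have : ∑ i, (r i • a j) ⊗ₜ[R] e i = a j ⊗ₜ[R] ∑ i, r i • e i := by
              rw [TensorProduct.tmul_sum]
              exact Finset.sum_congr rfl fun i _ => by rw [TensorProduct.smul_tmul]
            rw [this, hr, TensorProduct.tmul_zero]
          simp only [TensorProduct.sub_tmul, Finset.sum_sub_distrib, h3, sub_zero]
          rw [hvdef, Finset.smul_sum]
          rfl
        rw [h2, Fin.sum_univ_succAbove _ j]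
        simp
      obtain ⟨s, hs, hs0⟩ := ih T (fun i => e (j.succAbove i)) (fun i => he _)
        (fun i => r j • a (j.succAbove i) - r (j.succAbove i) • a j) (h1 ▸ hHs (r j))
      refine ⟨s * r j, hmul hs hj, ?_⟩
      rw [mul_smul, h1, hs0]
    by_cases hb0 : (1 : K) ⊗ₜ[R] a 0 = 0
    · obtain ⟨s, hs, hs0⟩ := loc0 p K hb0 (e 0) (he 0)
      have h1 : s • v = ∑ i : Fin n, (s • a i.succ) ⊗ₜ[R] e i.succ := by
        rw [hvdef, Fin.sum_univ_succ, smul_add, hs0, zero_add, Finset.smul_sum]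
        rfl
      obtain ⟨t, ht, ht0⟩ := ih T (fun i => e i.succ) (fun i => he _)
        (fun i => s • a i.succ) (h1 ▸ hHs s)
      refine ⟨t * s, hmul ht hs, ?_⟩
      rw [mul_smul, h1, ht0]
    -- the symmetric tensor trick
    have hsym : ∀ i, (1 : K) ⊗ₜ[R] (a i ⊗ₜ[R] a 0 - a 0 ⊗ₜ[R] a i) = 0 := by
      have hred : IsReduced (Ω ⊗[R] (T ⊗[R] T)) := isReduced_tensor_tensor ‹_›
      have hy : ∑ i, (a i ⊗ₜ[R] a 0 - a 0 ⊗ₜ[R] a i) ⊗ₜ[R] e i ∈ HH ψ φ (T ⊗[R] T) := by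
        have h1 := HH_map ψ φ (Algebra.TensorProduct.includeLeft : T →ₐ[R] T ⊗[R] T) hv
        have h2 := HH_map ψ φ (Algebra.TensorProduct.includeRight : T →ₐ[R] T ⊗[R] T) hv
        have h3 := sub_mem (Submodule.smul_mem _ ((1 : T) ⊗ₜ[R] a 0) h1)
          (Submodule.smul_mem _ (a 0 ⊗ₜ[R] (1 : T)) h2)
        convert h3 using 1
        rw [hvdef, map_sum, map_sum, Finset.smul_sum, Finset.smul_sum, ← Finset.sum_sub_distrib]
        refine Finset.sum_congr rfl fun i _ => ?_
        simp [TensorProduct.smul_tmul', TensorProduct.sub_tmul]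
      have hy' := hy
      rw [Fin.sum_univ_succ, sub_self, TensorProduct.zero_tmul, zero_add] at hy'
      obtain ⟨s, hs, hs0⟩ := ih (T ⊗[R] T) (fun i => e i.succ) (fun i => he _)
        (fun i => a i.succ ⊗ₜ[R] a 0 - a 0 ⊗ₜ[R] a i.succ) hy'
      have hs1 : ∑ i, (s • (a i ⊗ₜ[R] a 0 - a 0 ⊗ₜ[R] a i)) ⊗ₜ[R] e i = 0 := by
        rw [Fin.sum_univ_succ, sub_self, smul_zero, TensorProduct.zero_tmul, zero_add, ← hs0,
          Finset.smul_sum]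
        rfl
      intro i
      have h5 := indep0 p K e he hind _ hs1 i
      rw [TensorProduct.tmul_smul, ← algebraMap_smul K s] at h5
      refine (smul_eq_zero.mp h5).resolve_left ?_
      rwa [algebraMap_K_eq_zero p K]
    obtain ⟨f, hf⟩ := Module.Projective.exists_dual_ne_zero K hb0
    have hlam : ∀ i, (1 : K) ⊗ₜ[R] a i = (f (1 ⊗ₜ a i) / f (1 ⊗ₜ a 0)) • ((1 : K) ⊗ₜ[R] a 0) := by
      intro i
      rw [div_eq_inv_mul, mul_smul, prop_of_symm K f _ _ (hsym i), smul_smul, inv_mul_cancel₀ hf,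
        one_smul]
    obtain ⟨⟨d, hd⟩, hdi⟩ := IsLocalization.exist_integer_multiples_of_finite
      (nonZeroDivisors (R ⧸ p)) (fun i => f (1 ⊗ₜ a i) / f (1 ⊗ₜ a 0))
    obtain ⟨r, rfl⟩ := Ideal.Quotient.mk_surjective d
    have hr : r ∉ p := fun h => (nonZeroDivisors.ne_zero hd) (Ideal.Quotient.eq_zero_iff_mem.mpr h)
    have hri : ∀ i, ∃ c : R, algebraMap R K c =
        algebraMap R K r * (f (1 ⊗ₜ a i) / f (1 ⊗ₜ a 0)) := by
      intro i
      obtain ⟨c, hc⟩ := hdi i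
      obtain ⟨c, rfl⟩ := Ideal.Quotient.mk_surjective c
      refine ⟨c, ?_⟩
      rw [IsScalarTower.algebraMap_apply R (R ⧸ p) K c, IsScalarTower.algebraMap_apply R (R ⧸ p) K r]
      rw [Algebra.smul_def] at hc
      exact hc
    choose c hc using hri
    have hz : ∀ i, (1 : K) ⊗ₜ[R] (r • a i - c i • a 0) = 0 := by
      intro i
      rw [TensorProduct.tmul_sub, TensorProduct.tmul_smul, TensorProduct.tmul_smul, hlam i,
        ← algebraMap_smul K r, ← algebraMap_smul K (c i), smul_smul, hc, sub_self]
    choose s hs hs0 using fun i => loc0 p K (hz i) (e i) (he i)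
    let t := ∏ i, s i
    have ht : t ∉ p := by
      intro h
      obtain ⟨i, _, hi⟩ := (Ideal.IsPrime.prod_mem_iff).mp h
      exact hs i hi
    have ht0 : ∀ i, t • ((r • a i - c i • a 0) ⊗ₜ[R] e i) = 0 := by
      intro i
      obtain ⟨q, hq⟩ : s i ∣ t := Finset.dvd_prod_of_mem s (Finset.mem_univ i)
      rw [hq, mul_comm, mul_smul, hs0, smul_zero]
    let w := ∑ i, (t * c i) • e i
    have hw : (t * r) • v = a 0 ⊗ₜ[R] w := by
      rw [← sub_eq_zero, hvdef, TensorProduct.tmul_sum, Finset.smul_sum, ← Finset.sum_sub_distrib]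
      refine Finset.sum_eq_zero fun i _ => ?_
      rw [← ht0 i, TensorProduct.sub_tmul, smul_sub, mul_smul, TensorProduct.tmul_smul, mul_smul]
      congr 1
    by_cases hann : ∀ r : R, r • w = 0 → r ∈ p
    · exfalso
      have hnil : IsNilpotent ((1 : K) ⊗ₜ[R] a 0) :=
        key_nilp ψ φ p (fun r hr => (algebraMap_K_eq_zero p K).mpr hr) w hann (a 0)
          (hw ▸ hHs (t * r))
      have : IsReduced (K ⊗[R] T) := isReduced_K K Ω
      exact hb0 hnil.eq_zero
    · push Not at hann
      obtain ⟨q, hq, hqp⟩ := hann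
      refine ⟨q * (t * r), hmul hqp (hmul ht hr), ?_⟩
      rw [mul_smul, hw, ← TensorProduct.tmul_smul, hq, TensorProduct.tmul_zero]
end ind
end LIC

namespace LIC
open scoped TensorProduct
universe u
section main
variable {R B Q F : Type u} [CommRing R] [CommRing B] [CommRing Q] [Algebra R B] [Algebra R Q]
  [AddCommGroup F] [Module R F] (ψ : B →ₐ[R] Q) (φ : F →ₗ[R] Q)

theorem mem_range_of_killed {E T : Type u} [AddCommGroup E] [Module R E] [CommRing T] [Algebra R T]
    [Module.Flat R T] (p : Ideal R) (hp : p.FG) (x : T ⊗[R] E) (hx : ∀ r ∈ p, r • x = 0) :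
    ∃ (n : ℕ) (a : Fin n → T) (e : Fin n → E), (∀ i, ∀ r ∈ p, r • e i = 0) ∧
      x = ∑ i, a i ⊗ₜ[R] e i := by
  classical
  obtain ⟨s, hs⟩ := hp
  let g : E →ₗ[R] (s → E) := LinearMap.pi fun r => (r : R) • LinearMap.id
  have hg : g.lTensor T x = 0 := by
    apply (TensorProduct.piRight R R T (fun _ : s => E)).injective
    rw [map_zero]
    ext r
    have : TensorProduct.piRight R R T (fun _ : s => E) (g.lTensor T x) r = (r : R) • x := by
      clear hx
      induction x with
      | zero => simp
      | add x y hx hy => simp only [map_add, Pi.add_apply, hx, hy, smul_add]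
      | tmul a b => simp [g]
    rw [this, hx _ (hs ▸ Ideal.subset_span r.2), Pi.zero_apply]
  have hex : Function.Exact ((LinearMap.ker g).subtype.lTensor T) (g.lTensor T) :=
    Module.Flat.lTensor_exact T (LinearMap.exact_subtype_ker_map g)
  obtain ⟨z, hz⟩ := (hex _).mp hg
  obtain ⟨n, a, e, hae⟩ := TensorProduct.exists_sum_tmul_eq z
  refine ⟨n, a, fun i => e i, ?_, ?_⟩
  · intro i r hr
    have h1 : g (e i) = 0 := (e i).2
    rw [← hs] at hr
    induction hr using Submodule.span_induction with
    | mem r h => simpa [g] using congr_fun h1 ⟨r, h⟩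
    | zero => simp
    | add x y _ _ hx hy => rw [add_smul, hx, hy, add_zero]
    | smul c x _ hx => rw [smul_assoc, hx, smul_zero]
  · rw [← hz, hae, map_sum]
    simp

theorem HH_eq_bot [IsNoetherianRing R] (T : Type u) [CommRing T] [Algebra R T] [Module.Flat R T]
    (hred : ∀ (p : Ideal R) [p.IsPrime],
      IsReduced (AlgebraicClosure (FractionRing (R ⧸ p)) ⊗[R] T)) :
    HH ψ φ T = ⊥ := by
  by_contra hne
  let H := (HH ψ φ T).restrictScalars R
  have : Nontrivial H := by
    obtain ⟨x, hx, hx0⟩ := Submodule.exists_mem_ne_zero_of_ne_bot hne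
    exact ⟨⟨x, hx⟩, 0, fun h => hx0 congr(($h : T ⊗[R] EE ψ φ))⟩
  obtain ⟨p, hp⟩ := associatedPrimes.nonempty R H
  obtain ⟨hprime, ⟨x, hxH⟩, hx⟩ := isAssociatedPrime_iff.mp (AssociatedPrimes.mem_iff.mp hp)
  have hx' : ∀ r : R, r ∈ p ↔ r • x = 0 := by
    intro r
    rw [hx, Submodule.mem_colon_singleton, Submodule.mem_bot, Subtype.ext_iff]
    rfl
  obtain ⟨n, a, e, he, hxe⟩ := mem_range_of_killed p (IsNoetherian.noetherian p) x
    (fun r hr => (hx' r).mp hr)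
  have := hred p
  obtain ⟨s, hs, hs0⟩ := core_ind ψ φ p (FractionRing (R ⧸ p))
    (AlgebraicClosure (FractionRing (R ⧸ p))) n T e he a (hxe ▸ hxH)
  rw [← hxe] at hs0
  exact hs ((hx' s).mpr hs0)

theorem iclT_le [IsNoetherianRing R] (T : Type u) [CommRing T] [Algebra R T] [Module.Flat R T]
    (hred : ∀ (p : Ideal R) [p.IsPrime],
      IsReduced (AlgebraicClosure (FractionRing (R ⧸ p)) ⊗[R] T))
    (z : T ⊗[R] F) (hz : z ∈ iclT ψ φ T) : ∃ y, (icl ψ φ).subtype.baseChange T y = z := by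
  have h1 : (icl ψ φ).mkQ.baseChange T z ∈ HH ψ φ T := ⟨z, hz, rfl⟩
  rw [HH_eq_bot ψ φ T hred, Submodule.mem_bot] at h1
  have hex : Function.Exact ((icl ψ φ).subtype.lTensor T) ((icl ψ φ).mkQ.lTensor T) :=
    lTensor_exact T (LinearMap.exact_subtype_mkQ _) (Submodule.mkQ_surjective _)
  exact (hex _).mp h1
end main
end LIC

namespace LIC
open scoped TensorProduct
universe u
theorem IsNormalRing.isReduced {A : Type*} [CommRing A] (h : IsNormalRing A) : IsReduced A := by
  refine ⟨fun x hx => ?_⟩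
  by_contra hx0
  have h1 : Ideal.span {x} ≠ ⊥ := by simpa using hx0
  let I : Ideal A := LinearMap.ker (LinearMap.toSpanSingleton A A x)
  have hI : I ≠ ⊤ := by
    rw [Ideal.ne_top_iff_one]; simpa [I] using hx0
  obtain ⟨m, hm, hIm⟩ := Ideal.exists_le_maximal I hI
  have := (h m hm.isPrime).1
  have h2 : algebraMap A (Localization.AtPrime m) x = 0 := (hx.map _).eq_zero
  rw [IsLocalization.map_eq_zero_iff m.primeCompl] at h2
  obtain ⟨u, hu⟩ := h2
  exact u.2 (hIm (by simpa [I] using hu))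

theorem reduced_K {R : Type u} [CommRing R]
    (S : Type u) [CommRing S] [Algebra R S]
    (hnorm : LIC.HasGeometricallyNormalFibers.{u} R S) (p : Ideal R) [hp : p.IsPrime]
    (K : Type u) [Field K] [iF : Algebra (FractionRing (R ⧸ p)) K] [Algebra (R ⧸ p) K]
    [IsScalarTower (R ⧸ p) (FractionRing (R ⧸ p)) K] [Algebra R K] [IsScalarTower R (R ⧸ p) K]
    [hfin : FiniteDimensional (FractionRing (R ⧸ p)) K] : IsReduced (S ⊗[R] K) := by
  have hinj : Function.Injective (algebraMap (R ⧸ p) K) := by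
    rw [IsScalarTower.algebraMap_eq (R ⧸ p) (FractionRing (R ⧸ p)) K]
    exact (algebraMap (FractionRing (R ⧸ p)) K).injective.comp (IsFractionRing.injective (R ⧸ p) _)
  have hfs : FaithfulSMul (R ⧸ p) K := (faithfulSMul_iff_algebraMap_injective _ _).mpr hinj
  have hnz : NoZeroSMulDivisors (R ⧸ p) K := by
    refine ⟨fun {c x} h => ?_⟩
    rw [Algebra.smul_def, mul_eq_zero] at h
    exact h.imp (fun h => hinj (by rw [h, map_zero])) id
  have hK := hnorm p hp K inferInstance inferInstance hnz inferInstance inferInstance (by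
    have : FractionRing.liftAlgebra (R ⧸ p) K = iF := by
      apply Algebra.algebra_ext
      intro r
      have h : @algebraMap _ K _ _ (FractionRing.liftAlgebra (R ⧸ p) K) =
          @algebraMap _ K _ _ iF := by
        apply IsLocalization.ringHom_ext (nonZeroDivisors (R ⧸ p))
        rw [← IsScalarTower.algebraMap_eq (R ⧸ p) (FractionRing (R ⧸ p)) K]
        let _ := FractionRing.liftAlgebra (R ⧸ p) K
        exact (IsScalarTower.algebraMap_eq (R ⧸ p) (FractionRing (R ⧸ p)) K).symm
      exact congr($h r)
    rw [this]
    exact hfin)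
  have := hK.isReduced
  exact isReduced_of_injective (Algebra.TensorProduct.comm R S K) (AlgEquiv.injective _)

theorem reduced_sub {R : Type u} [CommRing R]
    (S : Type u) [CommRing S] [Algebra R S] [Module.Flat R S]
    (hnorm : LIC.HasGeometricallyNormalFibers.{u} R S) (p : Ideal R) [hp : p.IsPrime]
    (K : Type u) [Field K] [iF : Algebra (FractionRing (R ⧸ p)) K]
    [hfin : FiniteDimensional (FractionRing (R ⧸ p)) K]
    (A : Type u) [CommRing A] [Algebra R A] (f : A →+* K) (hf : Function.Injective f)
    (hc : ∀ r, f (algebraMap R A r) = algebraMap (FractionRing (R ⧸ p)) K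
      (algebraMap (R ⧸ p) (FractionRing (R ⧸ p)) (algebraMap R (R ⧸ p) r))) :
    IsReduced (S ⊗[R] A) := by
  let i1 : Algebra (R ⧸ p) K :=
    ((algebraMap (FractionRing (R ⧸ p)) K).comp (algebraMap (R ⧸ p) (FractionRing (R ⧸ p)))).toAlgebra
  let i2 : Algebra R K :=
    ((algebraMap (R ⧸ p) K).comp (algebraMap R (R ⧸ p))).toAlgebra
  have : IsScalarTower (R ⧸ p) (FractionRing (R ⧸ p)) K := IsScalarTower.of_algebraMap_eq' rfl
  have : IsScalarTower R (R ⧸ p) K := IsScalarTower.of_algebraMap_eq' rfl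
  have h2 : IsReduced (S ⊗[R] K) := reduced_K S hnorm p K
  let j : A →ₐ[R] K := { f with commutes' := hc }
  exact isReduced_of_injective (Algebra.TensorProduct.map (AlgHom.id R S) j)
    (Module.Flat.lTensor_preserves_injective_linearMap (M := S) j.toLinearMap hf)

theorem reduced_of_normal {R : Type u} [CommRing R]
    (S : Type u) [CommRing S] [Algebra R S] [Module.Flat R S]
    (hnorm : LIC.HasGeometricallyNormalFibers.{u} R S) (p : Ideal R) [hp : p.IsPrime] :
    IsReduced (AlgebraicClosure (FractionRing (R ⧸ p)) ⊗[R] S) := by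
  suffices h : IsReduced (S ⊗[R] AlgebraicClosure (FractionRing (R ⧸ p))) from
    isReduced_of_injective (Algebra.TensorProduct.comm R _ S) (AlgEquiv.injective _)
  apply IsReduced.tensorProduct_of_flat_of_forall_fg
  rintro B ⟨s, rfl⟩
  let K := IntermediateField.adjoin (FractionRing (R ⧸ p))
    (s : Set (AlgebraicClosure (FractionRing (R ⧸ p))))
  have hfin : FiniteDimensional (FractionRing (R ⧸ p)) K :=
    IntermediateField.finiteDimensional_adjoin
      (fun x _ => (Algebra.IsAlgebraic.isAlgebraic x).isIntegral)
  have hle : ∀ x ∈ Algebra.adjoin R (s : Set (AlgebraicClosure (FractionRing (R ⧸ p)))), x ∈ K := by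
    intro x hx
    induction hx using Algebra.adjoin_induction with
    | mem x h => exact IntermediateField.subset_adjoin _ _ h
    | algebraMap r =>
      rw [IsScalarTower.algebraMap_apply R (FractionRing (R ⧸ p))]
      exact K.algebraMap_mem _
    | add x y _ _ hx hy => exact add_mem hx hy
    | mul x y _ _ hx hy => exact mul_mem hx hy
  let j : Algebra.adjoin R (s : Set (AlgebraicClosure (FractionRing (R ⧸ p)))) →+* K :=
    { toFun := fun x => ⟨x.1, hle x.1 x.2⟩
      map_one' := rfl
      map_mul' := fun _ _ => rfl
      map_zero' := rfl
      map_add' := fun _ _ => rfl }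
  refine reduced_sub S hnorm p K _ j (fun x y h => Subtype.ext (congrArg (fun z : K => z.1) h)) ?_
  intro r
  apply Subtype.ext
  change algebraMap R (AlgebraicClosure (FractionRing (R ⧸ p))) r = _
  rw [IsScalarTower.algebraMap_apply R (FractionRing (R ⧸ p)),
    IsScalarTower.algebraMap_apply R (R ⧸ p) (FractionRing (R ⧸ p))]
  rfl
end LIC

namespace LIC
open scoped TensorProduct
universe u
theorem freeIC_map {R S : Type*} [CommRing R] [CommRing S] (f : R →+* S) {ι κ : Type*}
    (Φ : MvPolynomial ι R →+* MvPolynomial κ S)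
    (hΦ : ∀ r, Φ (MvPolynomial.C r) = MvPolynomial.C (f r))
    (h : (ι →₀ R) → (κ →₀ S)) (hh : ∀ x, Φ (symEmb R ι x) = symEmb S κ (h x))
    (U : Submodule R (ι →₀ R)) (V : Submodule S (κ →₀ S)) (hUV : ∀ x ∈ U, h x ∈ V)
    {x : ι →₀ R} (hx : x ∈ freeIC U) : h x ∈ freeIC V := by
  have hle : ∀ a ∈ Algebra.adjoin R (symEmb R ι '' U),
      Φ a ∈ Algebra.adjoin S (symEmb S κ '' V) := by
    intro a ha
    induction ha using Algebra.adjoin_induction with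
    | mem x hx =>
      obtain ⟨y, hy, rfl⟩ := hx
      rw [hh]
      exact Algebra.subset_adjoin ⟨_, hUV y hy, rfl⟩
    | algebraMap r =>
      rw [MvPolynomial.algebraMap_eq, hΦ]
      exact Subalgebra.algebraMap_mem _ (f r)
    | add x y _ _ hx hy => rw [map_add]; exact add_mem hx hy
    | mul x y _ _ hx hy => rw [map_mul]; exact mul_mem hx hy
  obtain ⟨p, hp, hpx⟩ := (show IsIntegral (Algebra.adjoin R (symEmb R ι '' U)) (symEmb R ι x) from hx)
  let j : Algebra.adjoin R (symEmb R ι '' U) →+* Algebra.adjoin S (symEmb S κ '' V) :=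
    { toFun := fun x => ⟨Φ x.1, hle x.1 x.2⟩
      map_one' := Subtype.ext (map_one Φ)
      map_mul' := fun _ _ => Subtype.ext (map_mul Φ _ _)
      map_zero' := Subtype.ext (map_zero Φ)
      map_add' := fun _ _ => Subtype.ext (map_add Φ _ _) }
  refine ⟨p.map j, hp.map j, ?_⟩
  have h2 : (algebraMap (Algebra.adjoin S (symEmb S κ '' V)) (MvPolynomial κ S)).comp j =
    Φ.comp (algebraMap (Algebra.adjoin R (symEmb R ι '' U)) (MvPolynomial ι R)) := rfl
  rw [Polynomial.eval₂_map, h2, ← hh, ← Polynomial.hom_eval₂, hpx, map_zero]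

theorem map_freeIC_le {S : Type*} [CommRing S] {ι κ N : Type*} [AddCommGroup N] [Module S N]
    (π₁ : (ι →₀ S) →ₗ[S] N) (π₂ : (κ →₀ S) →ₗ[S] N) (hsurj : Function.Surjective π₂)
    (L : Submodule S N) :
    (freeIC (L.comap π₁)).map π₁ ≤ (freeIC (L.comap π₂)).map π₂ := by
  rintro _ ⟨x, hx, rfl⟩
  let h : (ι →₀ S) →ₗ[S] (κ →₀ S) :=
    Finsupp.linearCombination S (fun i => Function.surjInv hsurj (π₁ (Finsupp.single i 1)))
  have hπ : ∀ y, π₂ (h y) = π₁ y := by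
    intro y
    have : π₂ ∘ₗ h = π₁ := by
      apply Finsupp.lhom_ext'
      intro i
      ext
      simp [h, Function.surjInv_eq]
    exact congr($this y)
  let Φ : MvPolynomial ι S →ₐ[S] MvPolynomial κ S :=
    MvPolynomial.aeval (fun i => symEmb S κ (h (Finsupp.single i 1)))
  refine ⟨h x, freeIC_map (RingHom.id S) Φ.toRingHom (fun r => ?_) h (fun y => ?_) _ _ ?_ hx, hπ x⟩
  · exact Φ.commutes r
  · have : Φ.toLinearMap ∘ₗ symEmb S ι = symEmb S κ ∘ₗ h := by
      apply Finsupp.lhom_ext'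
      intro i
      ext1
      simp [Φ, symEmb]
    exact congr($this y)
  · intro y hy
    simpa [hπ] using hy

theorem lic_indep {S : Type*} [CommRing S] {κ N : Type*} [AddCommGroup N] [Module S N]
    (π₂ : (κ →₀ S) →ₗ[S] N) (hsurj : Function.Surjective π₂) (L : Submodule S N) :
    lic L = (freeIC (L.comap π₂)).map π₂ :=
  le_antisymm (map_freeIC_le _ _ hsurj L)
    (map_freeIC_le _ _ (fun n => ⟨Finsupp.single n 1, by simp⟩) L)

section
variable {R : Type u} [CommRing R] (S : Type u) [CommRing S] [Algebra R S]
    {M : Type u} [AddCommGroup M] [Module R M] (L : Submodule R M)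

/-- presentation of the base change -/
noncomputable def pi2 : (M →₀ S) →ₗ[S] S ⊗[R] M :=
  Finsupp.linearCombination S (fun m => (1 : S) ⊗ₜ[R] m)

/-- the comparison of free modules -/
noncomputable def hS : (M →₀ S) →ₗ[S] S ⊗[R] (M →₀ R) :=
  Finsupp.linearCombination S (fun m => (1 : S) ⊗ₜ[R] Finsupp.single m (1 : R))

theorem pi2_surj : Function.Surjective (pi2 (R := R) S (M := M)) := by
  intro z
  induction z with
  | zero => exact ⟨0, map_zero _⟩
  | add x y hx hy =>
    obtain ⟨a, rfl⟩ := hx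
    obtain ⟨b, rfl⟩ := hy
    exact ⟨a + b, map_add _ _ _⟩
  | tmul s m => exact ⟨Finsupp.single m s, by simp [pi2, TensorProduct.smul_tmul']⟩

theorem hS_pi (z : M →₀ S) :
    (Finsupp.linearCombination R (id : M → M)).baseChange S (hS (R := R) S z) = pi2 S z := by
  have : (Finsupp.linearCombination R (id : M → M)).baseChange S ∘ₗ hS (R := R) S = pi2 S := by
    apply Finsupp.lhom_ext'
    intro i
    ext1
    simp [hS, pi2]
  exact congr($this z)

theorem mem_baseChange_comap {F : Type u} [AddCommGroup F] [Module R F] (π : F →ₗ[R] M)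
    (hπ : Function.Surjective π) (w : S ⊗[R] F) (hw : π.baseChange S w ∈ L.baseChange S) :
    w ∈ (L.comap π).baseChange S := by
  have h1 : ∀ v ∈ L.baseChange S, ∃ w' ∈ (L.comap π).baseChange S, π.baseChange S w' = v := by
    intro v hv
    rw [Submodule.baseChange_eq_span] at hv
    induction hv using Submodule.span_induction with
    | mem x hx =>
      obtain ⟨l, hl, rfl⟩ := hx
      obtain ⟨y, rfl⟩ := hπ l
      exact ⟨1 ⊗ₜ y, Submodule.tmul_mem_baseChange_of_mem _ hl, by simp⟩
    | zero => exact ⟨0, zero_mem _, map_zero _⟩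
    | add x y _ _ hx hy =>
      obtain ⟨a, ha, rfl⟩ := hx
      obtain ⟨b, hb, rfl⟩ := hy
      exact ⟨a + b, add_mem ha hb, map_add _ _ _⟩
    | smul c x _ hx =>
      obtain ⟨a, ha, rfl⟩ := hx
      exact ⟨c • a, Submodule.smul_mem _ _ ha, map_smul _ _ _⟩
  obtain ⟨w', hw', he⟩ := h1 _ hw
  have hex : Function.Exact ((LinearMap.ker π).subtype.lTensor S) (π.lTensor S) :=
    lTensor_exact S (LinearMap.exact_subtype_ker_map π) hπ
  have h0 : π.lTensor S (w - w') = 0 := by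
    have : π.baseChange S (w - w') = 0 := by rw [map_sub, he, sub_self]
    exact this
  obtain ⟨k, hk⟩ := (hex _).mp h0
  have h2 : w - w' ∈ (L.comap π).baseChange S := by
    rw [← hk]
    clear hk
    induction k with
    | zero => simp
    | add x y hx hy => rw [map_add]; exact add_mem hx hy
    | tmul s k =>
      exact Submodule.tmul_mem_baseChange_of_mem _ (by
        have : π k = 0 := k.2
        simp [this])
  simpa using add_mem h2 hw'

theorem baseChange_le : (lic L).baseChange S ≤ lic (L.baseChange S) := by
  rw [lic_indep (pi2 S) (pi2_surj S), Submodule.baseChange_eq_span, Submodule.span_le]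
  rintro _ ⟨_, ⟨x, hx, rfl⟩, rfl⟩
  let g : (M →₀ R) →ₗ[R] (M →₀ S) := Finsupp.mapRange.linearMap (Algebra.linearMap R S)
  have hg : ∀ y, pi2 S (g y) = (1 : S) ⊗ₜ[R] (Finsupp.linearCombination R (id : M → M) y) := by
    intro y
    induction y using Finsupp.induction_linear with
    | zero => simp
    | add x y hx hy => simp only [map_add, hx, hy, TensorProduct.tmul_add]
    | single m r =>
      simp [g, pi2]
  refine ⟨g x, freeIC_map (algebraMap R S) (MvPolynomial.map (algebraMap R S)) (by simp) g
    ?_ _ _ ?_ hx, hg x⟩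
  · intro y
    induction y using Finsupp.induction_linear with
    | zero => simp
    | add x y hx hy => simp only [map_add, hx, hy]
    | single m r => 
      have h : MvPolynomial.C (algebraMap R S r) * MvPolynomial.X m =
          r • (MvPolynomial.X m : MvPolynomial M S) := by
        rw [Algebra.smul_def]; rfl
      simpa [g, symEmb, MvPolynomial.smul_eq_C_mul] using h
  · intro y hy
    rw [Submodule.mem_comap, hg]
    exact Submodule.tmul_mem_baseChange_of_mem _ hy

theorem le_baseChange [IsNoetherianRing R] [Module.Flat R S]
    (hred : ∀ (p : Ideal R) [p.IsPrime],
      IsReduced (AlgebraicClosure (FractionRing (R ⧸ p)) ⊗[R] S)) :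
    lic (L.baseChange S) ≤ (lic L).baseChange S := by
  rw [lic_indep (pi2 S) (pi2_surj S)]
  rintro _ ⟨z, hz, rfl⟩
  let π := Finsupp.linearCombination R (id : M → M)
  have hπ : Function.Surjective π := fun n => ⟨Finsupp.single n 1, by simp [π]⟩
  let K := L.comap π
  let B := Algebra.adjoin R (symEmb R M '' K)
  let ψ : B →ₐ[R] MvPolynomial M R := B.val
  let φ := symEmb R M
  let Θ := MvPolynomial.algebraTensorAlgEquiv (σ := M) R S
  have hΘ : ∀ z, Θ (φ.baseChange S (hS (R := R) S z)) = symEmb S M z := by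
    intro z
    have : Θ.toLinearMap ∘ₗ φ.baseChange S ∘ₗ hS (R := R) S = symEmb S M := by
      apply Finsupp.lhom_ext'
      intro i
      ext1
      simp [hS, φ, symEmb, Θ]
    exact congr($this z)
  let ΨS : S ⊗[R] B →ₐ[S] S ⊗[R] MvPolynomial M R :=
    Algebra.TensorProduct.map (AlgHom.id S S) ψ
  have hΨ : ∀ x, ΨS x = psiT ψ S x := fun x => rfl
  let f : S ⊗[R] B →ₐ[S] MvPolynomial M S := Θ.toAlgHom.comp ΨS
  have hle : Algebra.adjoin S (symEmb S M '' ((L.baseChange S).comap (pi2 (R := R) S))) ≤ f.range := by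
    rw [Algebra.adjoin_le_iff]
    rintro _ ⟨k, hk, rfl⟩
    have h1 : hS (R := R) S k ∈ K.baseChange S := by
      apply mem_baseChange_comap S L π hπ
      rw [hS_pi S k]
      exact hk
    rw [← hΘ]
    generalize hS (R := R) S k = w at h1
    rw [Submodule.baseChange_eq_span] at h1
    induction h1 using Submodule.span_induction with
    | mem x hx =>
      obtain ⟨y, hy, rfl⟩ := hx
      refine ⟨1 ⊗ₜ ⟨φ y, Algebra.subset_adjoin ⟨y, hy, rfl⟩⟩, ?_⟩
      simp [f, ΨS, ψ]
    | zero => rw [map_zero, map_zero]; exact zero_mem f.range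
    | add x y _ _ hx hy => rw [map_add, map_add]; exact add_mem hx hy
    | smul c x _ hx => rw [map_smul, map_smul]; exact Subalgebra.smul_mem _ hx c
  have hmemT : hS (R := R) S z ∈ iclT ψ φ S := by
    obtain ⟨p, hp, hpx⟩ := (show IsIntegral (Algebra.adjoin S
      (symEmb S M '' ((L.baseChange S).comap (pi2 (R := R) S)))) (symEmb S M z) from hz)
    let q := p.map (algebraMap _ (MvPolynomial M S))
    have hq : q ∈ Polynomial.lifts f.toRingHom := by
      rw [Polynomial.lifts_iff_coeff_lifts]
      intro n
      rw [Polynomial.coeff_map]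
      exact hle (p.coeff n).2
    obtain ⟨q', hq', _, hm⟩ := Polynomial.lifts_and_natDegree_eq_and_monic hq (hp.map _)
    refine ⟨q', hm, ?_⟩
    apply Θ.injective
    rw [map_zero]
    have h3 : q.eval (symEmb S M z) = 0 := by
      rw [Polynomial.eval_map]; exact hpx
    rw [← hq', Polynomial.eval_map, ← hΘ] at h3
    rw [← h3]
    exact Polynomial.hom_eval₂ q' (psiT ψ S) (Θ.toAlgHom.toRingHom) _
  obtain ⟨y, hy⟩ := iclT_le ψ φ S hred _ hmemT
  rw [← hS_pi, ← hy]
  clear hy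
  induction y with
  | zero => simp
  | add a b ha hb => rw [map_add, map_add]; exact add_mem ha hb
  | tmul s x =>
    exact Submodule.tmul_mem_baseChange_of_mem _ ⟨x.1, x.2, rfl⟩
end
end LIC

universe u

/-- **Normal base change.** If `R → S` is a flat homomorphism of Noetherian
rings with geometrically normal fibers, then for `R`-modules `L ⊆ M`, the image of
`lic(L,M) ⊗_R S → M ⊗_R S` equals the liftable integral closure, as `S`-modules, of the
image of `L ⊗_R S → M ⊗_R S` inside `M ⊗_R S`. -/
theorem lic_normal_baseChange {R : Type u} [CommRing R] [IsNoetherianRing R]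
    (S : Type u) [CommRing S] [IsNoetherianRing S] [Algebra R S] [Module.Flat R S]
    (hnorm : LIC.HasGeometricallyNormalFibers.{u} R S)
    {M : Type u} [AddCommGroup M] [Module R M] (L : Submodule R M) :
    Submodule.baseChange S (LIC.lic L) = LIC.lic (Submodule.baseChange S L) := by
  exact le_antisymm (LIC.baseChange_le S L)
    (LIC.le_baseChange S L (fun p _ => LIC.reduced_of_normal S hnorm p))
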